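/- Let α = cos(θ)·e^{iα₁} and β = sin(θ)·e^{iβ₁} with θ ∈ [0, π/2] and α₁, β₁ real. Then for real r, t, φ, the equation α·cos(rt) + e^{iφ}·β·sin(rt) = 0 holds if and only if cos((α₁−β₁−φ)/2)·cos(θ−rt) = 0 and sin((α₁−β₁−φ)/2)·cos(θ+rt) = 0. -/

import Mathlib

open Complex Real

/-- With `α = cos θ e^{iα₁}` and `β = sin θ e^{iβ₁}`, `θ ∈ [0, π/2]`, the equation
`α cos(rt) + e^{iφ} β sin(rt) = 0` holds if and only if
`cos((α₁ - β₁ - φ)/2) cos(θ - rt) = 0` and `sin((α₁ - β₁ - φ)/2) cos(θ + rt) = 0`. -/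
theorem vanishing_first_component_iff (θ α₁ β₁ r t φ : ℝ)
    (hθ : θ ∈ Set.Icc 0 (π / 2)) :
    ((Real.cos θ : ℂ) * Complex.exp (α₁ * Complex.I) * (Real.cos (r * t) : ℂ) +
        Complex.exp (φ * Complex.I) * ((Real.sin θ : ℂ) * Complex.exp (β₁ * Complex.I)) *
          (Real.sin (r * t) : ℂ) = 0) ↔
      (Real.cos ((α₁ - β₁ - φ) / 2) * Real.cos (θ - r * t) = 0 ∧
        Real.sin ((α₁ - β₁ - φ) / 2) * Real.cos (θ + r * t) = 0) := by
  have key : ((Real.cos θ : ℂ) * Complex.exp (α₁ * Complex.I) * (Real.cos (r * t) : ℂ) +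
        Complex.exp (φ * Complex.I) * ((Real.sin θ : ℂ) * Complex.exp (β₁ * Complex.I)) *
          (Real.sin (r * t) : ℂ)) =
      Complex.exp (((α₁ + β₁ + φ) / 2 : ℝ) * Complex.I) *
        (((Real.cos ((α₁ - β₁ - φ) / 2) * Real.cos (θ - r * t) : ℝ) : ℂ) +
          ((Real.sin ((α₁ - β₁ - φ) / 2) * Real.cos (θ + r * t) : ℝ) : ℂ) * Complex.I) := by
    have h1 : Complex.exp (α₁ * Complex.I) =
        Complex.exp (((α₁ + β₁ + φ) / 2 : ℝ) * Complex.I) *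
          (Complex.cos (((α₁ - β₁ - φ) / 2 : ℝ) : ℂ) +
            Complex.sin (((α₁ - β₁ - φ) / 2 : ℝ) : ℂ) * Complex.I) := by
      rw [← Complex.exp_mul_I, ← Complex.exp_add]
      congr 1
      push_cast
      ring
    have h2 : Complex.exp (φ * Complex.I) * Complex.exp (β₁ * Complex.I) =
        Complex.exp (((α₁ + β₁ + φ) / 2 : ℝ) * Complex.I) *
          (Complex.cos (((α₁ - β₁ - φ) / 2 : ℝ) : ℂ) -
            Complex.sin (((α₁ - β₁ - φ) / 2 : ℝ) : ℂ) * Complex.I) := by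
      have h3 := Complex.exp_mul_I (-(((α₁ - β₁ - φ) / 2 : ℝ) : ℂ))
      rw [Complex.cos_neg, Complex.sin_neg, neg_mul (Complex.sin _), ← sub_eq_add_neg] at h3
      rw [← h3, ← Complex.exp_add, ← Complex.exp_add]
      congr 1
      push_cast
      ring
    rw [Real.cos_sub, Real.cos_add, h1]
    simp only [Complex.ofReal_mul, Complex.ofReal_add, Complex.ofReal_sub,
      Complex.ofReal_cos ((α₁ - β₁ - φ) / 2), Complex.ofReal_sin ((α₁ - β₁ - φ) / 2)]
    linear_combination ((Real.sin θ : ℂ) * (Real.sin (r * t) : ℂ)) * h2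
  rw [key, mul_eq_zero, or_iff_right (Complex.exp_ne_zero _), Complex.ext_iff]
  simp only [Complex.add_re, Complex.add_im, Complex.ofReal_re, Complex.ofReal_im,
    Complex.re_ofReal_mul, Complex.im_ofReal_mul, Complex.I_re, Complex.I_im, mul_zero, mul_one,
    add_zero, zero_add, Complex.zero_re, Complex.zero_im]
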